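/- arXiv:1701.06686 — 2 statements merged into one kernel-verified Lean document; each statement's English description precedes it below -/
import Mathlib

section
/- Let 𝒢 be a DAG with vertex set V ∪̇ L. For disjoint subsets A, B, C ⊆ V (C possibly empty), A is d-separated from B given C in 𝒢 if and only if A is m-separated from B given C in the latent projection 𝒢(V). -/
open scoped Classical
open Finset

namespace Nested

/-- A directed mixed graph: directed (`dir`) and bidirected (`bi`) edges. -/
structure MixedGraph (Vt : Type) where
  dir : Vt → Vt → Prop
  bi : Vt → Vt → Prop

/-- A step along a path: an edge traversed from `src` to `tgt`, with Booleans
recording whether there is an arrowhead at the `src` (resp. `tgt`) end. -/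
structure Step (Vt : Type) where
  src : Vt
  tgt : Vt
  hsrc : Bool
  htgt : Bool

/-- The step corresponds to an actual edge of the mixed graph `M`. -/
def StepIn {Vt : Type} (M : MixedGraph Vt) (s : Step Vt) : Prop :=
  (s.hsrc = false ∧ s.htgt = true ∧ M.dir s.src s.tgt) ∨
  (s.hsrc = true ∧ s.htgt = false ∧ M.dir s.tgt s.src) ∨
  (s.hsrc = true ∧ s.htgt = true ∧ M.bi s.src s.tgt)

/-- `IsWalk M a p b`: `p` is a walk in `M` from `a` to `b`. -/
def IsWalk {Vt : Type} (M : MixedGraph Vt) : Vt → List (Step Vt) → Vt → Prop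
  | a, [], b => a = b
  | a, s :: p, b => s.src = a ∧ StepIn M s ∧ IsWalk M s.tgt p b

/-- The list of vertices visited by a walk starting at `a`. -/
def wverts {Vt : Type} (a : Vt) (p : List (Step Vt)) : List Vt :=
  a :: p.map Step.tgt

/-- The non-endpoint (interior) vertices of a walk. -/
def interiorVerts {Vt : Type} (p : List (Step Vt)) : List Vt :=
  (p.map Step.tgt).dropLast

variable {Vt : Type} [Fintype Vt] [DecidableEq Vt]

/-- `z` is an ancestor (via directed edges) of some element of `C`. -/
def ancOf (M : MixedGraph Vt) (C : Finset Vt) (z : Vt) : Prop :=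
  ∃ c ∈ C, Relation.ReflTransGen M.dir z c

/-- The common vertex of two consecutive steps is a collider. -/
def Collider {Vt : Type} (s t : Step Vt) : Prop := s.htgt = true ∧ t.hsrc = true

/-- The interior vertex shared by consecutive steps `s`, `t` satisfies the
m-connection requirement given `C`: colliders are ancestors of `C`,
non-colliders lie outside `C`. -/
def jointOK (M : MixedGraph Vt) (C : Finset Vt) (s t : Step Vt) : Prop :=
  (Collider s t ∧ ancOf M C s.tgt) ∨ (¬ Collider s t ∧ s.tgt ∉ C)

/-- `a` and `b` are m-connected given `C` in `M`: there is a path (walk with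
distinct vertices) from `a` to `b` every non-collider of which avoids `C` and
every collider of which is an ancestor of `C`. -/
def MConn (M : MixedGraph Vt) (C : Finset Vt) (a b : Vt) : Prop :=
  ∃ p : List (Step Vt), IsWalk M a p b ∧ (wverts a p).Nodup ∧
    List.Chain' (jointOK M C) p

/-- m-separation of the sets `A` and `B` given `C` in `M`. -/
def MSep (M : MixedGraph Vt) (A B C : Finset Vt) : Prop :=
  ∀ a ∈ A, ∀ b ∈ B, ¬ MConn M C a b

/-- There is a directed path from `v` to `w` in `M` all of whose
non-endpoint vertices lie in `L`. -/
def DirVia (M : MixedGraph Vt) (L : Finset Vt) (v w : Vt) : Prop :=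
  ∃ p : List (Step Vt), p ≠ [] ∧ IsWalk M v p w ∧ (wverts v p).Nodup ∧
    (∀ s ∈ p, s.hsrc = false ∧ s.htgt = true) ∧
    (∀ z ∈ interiorVerts p, z ∈ L)

/-- There is a path between `v` and `w` in `M` with arrowheads at both
endpoints, all of whose non-endpoint vertices are non-colliders lying in `L`. -/
def BiVia (M : MixedGraph Vt) (L : Finset Vt) (v w : Vt) : Prop :=
  ∃ p : List (Step Vt), p ≠ [] ∧ IsWalk M v p w ∧ (wverts v p).Nodup ∧
    (∀ s, p.head? = some s → s.hsrc = true) ∧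
    (∀ s, p.getLast? = some s → s.htgt = true) ∧
    (∀ z ∈ interiorVerts p, z ∈ L) ∧
    List.Chain' (fun s t => ¬ Collider s t) p

/-- A (pre-)conditional acyclic directed mixed graph: a mixed graph together
with disjoint finite sets `V` of random and `W` of fixed vertices.  The
well-formedness conditions are collected in `PreCADMG.WF`. -/
structure PreCADMG (Vt : Type) where
  dir : Vt → Vt → Prop
  bi : Vt → Vt → Prop
  V : Finset Vt
  W : Finset Vt

/-- The underlying mixed graph of a CADMG. -/
def PreCADMG.mg {Vt : Type} (G : PreCADMG Vt) : MixedGraph Vt := ⟨G.dir, G.bi⟩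

/-- Well-formedness: `V` and `W` are disjoint, `bi` is symmetric, all edges
join vertices of `V ∪ W`, directed and bidirected edges never point into `W`,
and there are no directed cycles.  (So `WF` with `W = ∅` says: ADMG.) -/
def PreCADMG.WF {Vt : Type} (G : PreCADMG Vt) : Prop :=
  Disjoint G.V G.W ∧
  (∀ a b, G.bi a b → G.bi b a) ∧
  (∀ a b, G.dir a b → a ∈ G.V ∪ G.W ∧ b ∈ G.V) ∧
  (∀ a b, G.bi a b → a ∈ G.V ∧ b ∈ G.V) ∧
  (∀ v, ¬ Relation.TransGen G.dir v v)

/-- The district of `v`: random vertices joined to `v` by a bidirected path. -/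
noncomputable def dis (G : PreCADMG Vt) (v : Vt) : Finset Vt :=
  G.V.filter (fun w => Relation.ReflTransGen G.bi v w)

/-- The set of districts of `G`. -/
noncomputable def districts (G : PreCADMG Vt) : Finset (Finset Vt) :=
  G.V.image (dis G)

/-- Descendants of `v` (including `v` itself, among the vertices of `G`). -/
noncomputable def deF (G : PreCADMG Vt) (v : Vt) : Finset Vt :=
  (G.V ∪ G.W).filter (fun w => Relation.ReflTransGen G.dir v w)

/-- Non-descendants of `v`. -/
noncomputable def ndF (G : PreCADMG Vt) (v : Vt) : Finset Vt :=
  (G.V ∪ G.W) \ deF G v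

/-- Ancestors of the set `D` (including `D`). -/
noncomputable def anS (G : PreCADMG Vt) (D : Finset Vt) : Finset Vt :=
  (G.V ∪ G.W).filter (fun a => ∃ d ∈ D, Relation.ReflTransGen G.dir a d)

/-- Parents of the set `D`. -/
noncomputable def paS (G : PreCADMG Vt) (D : Finset Vt) : Finset Vt :=
  (G.V ∪ G.W).filter (fun a => ∃ d ∈ D, G.dir a d)

/-- Markov blanket: `mb(t) = pa(dis(t)) ∪ (dis(t) \ {t})`. -/
noncomputable def mb (G : PreCADMG Vt) (t : Vt) : Finset Vt :=
  paS G (dis G t) ∪ (dis G t).erase t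

/-- `v` is fixable in `G`: `v` is random and `dis(v) ∩ de(v) = {v}`. -/
def fixable (G : PreCADMG Vt) (v : Vt) : Prop :=
  v ∈ G.V ∧ dis G v ∩ deF G v = {v}

/-- The set `𝔽(G)` of fixable vertices. -/
noncomputable def FixF (G : PreCADMG Vt) : Finset Vt :=
  G.V.filter (fun v => fixable G v)

/-- The graph `φ_r(G)`:  `r` becomes fixed and edges with an arrowhead at `r`
are deleted. -/
def fixG (G : PreCADMG Vt) (r : Vt) : PreCADMG Vt where
  dir a b := G.dir a b ∧ b ≠ r
  bi a b := G.bi a b ∧ a ≠ r ∧ b ≠ r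
  V := G.V.erase r
  W := insert r G.W

/-- The induced subgraph on `A`, preserving random/fixed status. -/
def induce (G : PreCADMG Vt) (A : Finset Vt) : PreCADMG Vt where
  dir a b := G.dir a b ∧ a ∈ A ∧ b ∈ A
  bi a b := G.bi a b ∧ a ∈ A ∧ b ∈ A
  V := G.V ∩ A
  W := G.W ∩ A

/-- `A` is an ancestral set in `G`. -/
def Ancestral (G : PreCADMG Vt) (A : Finset Vt) : Prop :=
  A ⊆ G.V ∪ G.W ∧
  ∀ a ∈ A, ∀ b ∈ G.V ∪ G.W, Relation.ReflTransGen G.dir b a → b ∈ A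

/-- `ord` is (the rank function of) a topological total ordering for `G`:
if `a ≺ b` then `a` is not a descendant of `b`. -/
def IsTopo (G : PreCADMG Vt) (ord : Vt → ℕ) : Prop :=
  Function.Injective ord ∧
  ∀ a b, ord a < ord b → ¬ Relation.ReflTransGen G.dir b a

/-- The predecessors of `d` in the ordering `ord`. -/
noncomputable def preF (G : PreCADMG Vt) (ord : Vt → ℕ) (d : Vt) : Finset Vt :=
  (G.V ∪ G.W).filter (fun a => ord a < ord d)

/-- The graph `G^{|W}`: all pairs of fixed vertices joined by bidirected
edges. -/
def augMG (G : PreCADMG Vt) : MixedGraph Vt :=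
  ⟨G.dir, fun a b => G.bi a b ∨ (a ∈ G.W ∧ b ∈ G.W ∧ a ≠ b)⟩

/-- Adjacency in the augmented graph `(G)^a`: joined in `G^{|W}` by a path on
which every non-endpoint vertex is a collider. -/
def augEdge (G : PreCADMG Vt) (a b : Vt) : Prop :=
  a ≠ b ∧ ∃ p : List (Step Vt), p ≠ [] ∧ IsWalk (augMG G) a p b ∧
    (wverts a p).Nodup ∧ List.Chain' Collider p

/-- Undirected separation of `a` from `b` by `C` (w.r.t. adjacency `E`). -/
def USepPt (E : Vt → Vt → Prop) (C : Finset Vt) (a b : Vt) : Prop :=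
  ∀ l : List Vt, l.Chain' E → l.head? = some a → l.getLast? = some b →
    l.Nodup → ∃ v ∈ l, v ∈ C

/-- Undirected separation of `A` from `B` by `C`. -/
def USep (E : Vt → Vt → Prop) (C A B : Finset Vt) : Prop :=
  ∀ a ∈ A, ∀ b ∈ B, USepPt E C a b

/-- The latent projection of `G` obtained by projecting out the (random)
vertices in `H`. -/
def project (G : PreCADMG Vt) (H : Finset Vt) : PreCADMG Vt where
  dir v w := v ∈ (G.V \ H) ∪ G.W ∧ w ∈ G.V \ H ∧ v ≠ w ∧ DirVia G.mg H v w
  bi v w := v ∈ G.V \ H ∧ w ∈ G.V \ H ∧ v ≠ w ∧ BiVia G.mg H v w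
  V := G.V \ H
  W := G.W

/-! ## Kernels -/

variable {𝔛 : Vt → Type} [∀ v, Fintype (𝔛 v)]

/-- Sum a function of a joint state over all assignments to the coordinates in
`S`, the remaining coordinates being given by `x`. -/
noncomputable def sumOver (S : Finset Vt) (f : (∀ v, 𝔛 v) → ℝ) (x : ∀ v, 𝔛 v) : ℝ :=
  ∑ y : ((v : {v : Vt // v ∈ S}) → 𝔛 v.1),
    f (fun v => if h : v ∈ S then y ⟨v, h⟩ else x v)

/-- `f` depends only on the coordinates in `S`. -/
def DepOn (f : (∀ v, 𝔛 v) → ℝ) (S : Finset Vt) : Prop :=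
  ∀ x y : ∀ v, 𝔛 v, (∀ v ∈ S, x v = y v) → f x = f y

/-- `q` is a kernel `q_V(x_V | x_W)`: a nonnegative function of `(x_V, x_W)`
with `∑_{x_V} q_V(x_V | x_W) = 1` for every `x_W`. -/
def IsKernel (V W : Finset Vt) (q : (∀ v, 𝔛 v) → ℝ) : Prop :=
  (∀ x, 0 ≤ q x) ∧ DepOn q (V ∪ W) ∧ ∀ x, sumOver V q x = 1

/-- Case (a) of the definition of kernel conditional independence
`X_A ⫫ X_B | X_C [q_V]`:  `A ∩ W = ∅` and the conditional kernel
`q_V(x_A | x_B, x_C, x_{W∖(B∪C)})` is, wherever defined, a function of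
`x_A, x_C` only. -/
def KIndepA (V W : Finset Vt) (q : (∀ v, 𝔛 v) → ℝ) (A B C : Finset Vt) : Prop :=
  A ∩ W = ∅ ∧
  ∀ x y : ∀ v, 𝔛 v, (∀ v ∈ A ∪ C, x v = y v) →
    0 < sumOver (V \ (B ∪ C)) q x → 0 < sumOver (V \ (B ∪ C)) q y →
    sumOver (V \ (A ∪ B ∪ C)) q x / sumOver (V \ (B ∪ C)) q x =
      sumOver (V \ (A ∪ B ∪ C)) q y / sumOver (V \ (B ∪ C)) q y

/-- Kernel conditional independence `X_A ⫫ X_B | X_C [q_V]`. -/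
def KIndep (V W : Finset Vt) (q : (∀ v, 𝔛 v) → ℝ) (A B C : Finset Vt) : Prop :=
  KIndepA V W q A B C ∨ KIndepA V W q B A C

/-- The conditional kernel `q_V(x_d | x_T)` (as a function of the joint
state). -/
noncomputable def condOn (V : Finset Vt) (q : (∀ v, 𝔛 v) → ℝ) (d : Vt)
    (T : Finset Vt) : (∀ v, 𝔛 v) → ℝ :=
  fun x => sumOver (V \ insert d T) q x / sumOver (V \ T) q x

/-- The kernel `q*_{V∖H} = q_V / q_V(x_H | x_T, x_W)` obtained by fixing `H`. -/
noncomputable def qstar (V H T : Finset Vt) (q : (∀ v, 𝔛 v) → ℝ) :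
    (∀ v, 𝔛 v) → ℝ :=
  fun x => q x / (sumOver (V \ (H ∪ T)) q x / sumOver (V \ T) q x)

/-- The kernel fixing operation `φ_r(q; G) = q / q_V(x_r | x_{mb_G(r)})`. -/
noncomputable def fixK (G : PreCADMG Vt) (r : Vt) (q : (∀ v, 𝔛 v) → ℝ) :
    (∀ v, 𝔛 v) → ℝ :=
  fun x => q x / condOn G.V q r (mb G r) x

/-- The global Markov property for a CADMG (`q ∈ 𝒫^c_m(G)`). -/
def Pcm (G : PreCADMG Vt) (q : (∀ v, 𝔛 v) → ℝ) : Prop :=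
  ∀ A B C : Finset Vt, A ⊆ G.V ∪ G.W → B ⊆ G.V ∪ G.W → C ⊆ G.V ∪ G.W →
    Disjoint A B → Disjoint A C → Disjoint B C →
    MSep (augMG G) A B C → KIndep G.V G.W q A B C

/-- The augmented Markov property for a CADMG (`q ∈ 𝒫^c_a(G)`). -/
def Pca (G : PreCADMG Vt) (q : (∀ v, 𝔛 v) → ℝ) : Prop :=
  ∀ A B C : Finset Vt, A ⊆ G.V ∪ G.W → B ⊆ G.V ∪ G.W → C ⊆ G.V ∪ G.W →
    Disjoint A B → Disjoint A C → Disjoint B C →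
    USep (augEdge (induce G (anS G (A ∪ B ∪ C)))) C A B →
    KIndep G.V G.W q A B C

/-- The local Markov property for `G` at `t`. -/
def LocalAt (G : PreCADMG Vt) (q : (∀ v, 𝔛 v) → ℝ) (t : Vt) : Prop :=
  KIndep G.V G.W q {t} ((G.V ∪ G.W) \ insert t (mb G t)) (mb G t)

/-- The ordered local Markov property for a CADMG (`q ∈ 𝒫^c_l(G, ≺)`). -/
def Pcl (G : PreCADMG Vt) (ord : Vt → ℕ) (q : (∀ v, 𝔛 v) → ℝ) : Prop :=
  ∀ A : Finset Vt, Ancestral G A → ∀ m ∈ A, (∀ a ∈ A, ord a ≤ ord m) →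
    m ∈ G.V →
    LocalAt (induce G ((G.V ∩ A) ∪ G.W)) (sumOver (G.V \ A) q) m

/-- Tian factorization for a CADMG (`q ∈ 𝒫^c_f(G)`). -/
def Pcf (G : PreCADMG Vt) (q : (∀ v, 𝔛 v) → ℝ) : Prop :=
  ∀ A : Finset Vt, Ancestral G A →
    ∃ f : Finset Vt → ((∀ v, 𝔛 v) → ℝ),
      (∀ D ∈ districts (induce G A), IsKernel D (paS G D \ D) (f D)) ∧
      ∀ x, sumOver (G.V \ A) q x = ∏ D ∈ districts (induce G A), f D x

/-- `T^{(d,D)}_≺ = mb_G(d, an_G(D) ∩ pre_≺(d))`. -/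
noncomputable def Tset (G : PreCADMG Vt) (ord : Vt → ℕ) (d : Vt)
    (D : Finset Vt) : Finset Vt :=
  mb (induce G (insert d (anS G D ∩ preF G ord d))) d

/-- The district kernel
`q_D(x_D | x_{pa(D)∖D}) = ∏_{d ∈ D} q_V(x_d | x_{T^{(d,D)}_≺})`. -/
noncomputable def qD (G : PreCADMG Vt) (ord : Vt → ℕ)
    (q : (∀ v, 𝔛 v) → ℝ) (D : Finset Vt) : (∀ v, 𝔛 v) → ℝ :=
  fun x => ∏ d ∈ D, condOn G.V q d (Tset G ord d D) x

/-! ## Fixing sequences and nested Markov properties -/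

/-- Iterated graph fixing. -/
def fixGs : PreCADMG Vt → List Vt → PreCADMG Vt
  | G, [] => G
  | G, r :: rs => fixGs (fixG G r) rs

/-- Iterated kernel fixing. -/
noncomputable def fixKs : PreCADMG Vt → ((∀ v, 𝔛 v) → ℝ) → List Vt →
    ((∀ v, 𝔛 v) → ℝ)
  | _, q, [] => q
  | G, q, r :: rs => fixKs (fixG G r) (fixK G r q) rs

/-- A valid fixing sequence: each vertex is fixable when its turn comes. -/
def ValidSeq : PreCADMG Vt → List Vt → Prop
  | _, [] => True
  | G, r :: rs => fixable G r ∧ ValidSeq (fixG G r) rs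

/-- The global nested Markov property for an ADMG. -/
def NestedGlobal (G : PreCADMG Vt) (p : (∀ v, 𝔛 v) → ℝ) : Prop :=
  ∀ ws : List Vt, ValidSeq G ws → Pcm (fixGs G ws) (fixKs G p ws)

/-- `C` is intrinsic in `G`: a district of a reachable CADMG. -/
def Intrinsic (G : PreCADMG Vt) (C : Finset Vt) : Prop :=
  ∃ ws : List Vt, ws.Nodup ∧ ValidSeq G ws ∧ C ∈ districts (fixGs G ws)

/-- The ordered local nested Markov property for an ADMG. -/
def NestedLocal (G : PreCADMG Vt) (ord : Vt → ℕ) (p : (∀ v, 𝔛 v) → ℝ) : Prop :=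
  ∀ C : Finset Vt, Intrinsic G C →
    ∀ ws : List Vt, ws.Nodup → ValidSeq G ws → ws.toFinset = G.V \ C →
      ∀ m ∈ C, (∀ c ∈ C, ord c ≤ ord m) →
        LocalAt (fixGs G ws) (fixKs G p ws) m

end Nested

namespace Nested

/-- `Linked M J a m b n`: there is a nonempty walk in `M` from `a` to `b` whose marks at the
endpoints are `m` and `n` (`true` being an arrowhead) and which satisfies `J z k l` whenever it
enters an interior vertex `z` with mark `k` and leaves it with mark `l`. -/
inductive Linked {Vt : Type} (M : MixedGraph Vt) (J : Vt → Bool → Bool → Prop)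
    (a : Vt) (m : Bool) : Vt → Bool → Prop
  | single {b : Vt} {n : Bool} : StepIn M ⟨a, b, m, n⟩ → Linked M J a m b n
  | snoc {z b : Vt} {k l n : Bool} : Linked M J a m z k → J z k l → StepIn M ⟨z, b, l, n⟩ →
      Linked M J a m b n

/-- `LinkedPath M J a m p b n`: the list `p` of steps is a path that witnesses
`Linked M J a m b n`. -/
inductive LinkedPath {Vt : Type} (M : MixedGraph Vt) (J : Vt → Bool → Bool → Prop)
    (a : Vt) (m : Bool) : List (Step Vt) → Vt → Bool → Prop
  | single {b : Vt} {n : Bool} : b ≠ a → StepIn M ⟨a, b, m, n⟩ →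
      LinkedPath M J a m [⟨a, b, m, n⟩] b n
  | snoc {p : List (Step Vt)} {z b : Vt} {k l n : Bool} : LinkedPath M J a m p z k → J z k l →
      StepIn M ⟨z, b, l, n⟩ → b ∉ wverts a p →
      LinkedPath M J a m (p ++ [⟨z, b, l, n⟩]) b n

/-- The joint condition of m-connection given `C`, in terms of marks. -/
def markOK {Vt : Type} (M : MixedGraph Vt) (C : Finset Vt) (v : Vt) (k l : Bool) : Prop :=
  ((k = true ∧ l = true) ∧ ancOf M C v) ∨ (¬ (k = true ∧ l = true) ∧ v ∉ C)

/-- The interior vertex `v` is a non-collider in `L`. -/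
def latentOK {Vt : Type} (L : Finset Vt) (v : Vt) (k l : Bool) : Prop :=
  v ∈ L ∧ ¬ (k = true ∧ l = true)

section Walks

variable {Vt : Type} {M : MixedGraph Vt} {J : Vt → Bool → Bool → Prop}
  {a b c : Vt} {k l m n : Bool}

theorem StepIn.reverse (hM : ∀ v w, M.bi v w → M.bi w v) (h : StepIn M ⟨a, b, m, n⟩) :
    StepIn M ⟨b, a, n, m⟩ := by
  rcases h with ⟨h1, h2, h⟩ | ⟨h1, h2, h⟩ | ⟨h1, h2, h⟩
  · exact Or.inr (Or.inl ⟨h2, h1, h⟩)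
  · exact Or.inl ⟨h2, h1, h⟩
  · exact Or.inr (Or.inr ⟨h2, h1, hM _ _ h⟩)

theorem Linked.trans (h : Linked M J a m b n) (hJ : J b n k) (h' : Linked M J b k c l) :
    Linked M J a m c l := by
  induction h' with
  | single hs => exact h.snoc hJ hs
  | snoc _ hz hs ih => exact ih.snoc hz hs

theorem Linked.reverse (hM : ∀ v w, M.bi v w → M.bi w v) (hJ : ∀ v k l, J v k l → J v l k)
    (h : Linked M J a m b n) : Linked M J b n a m := by
  induction h with
  | single hs => exact .single (hs.reverse hM)
  | snoc _ hz hs ih => exact (Linked.single (hs.reverse hM)).trans (hJ _ _ _ hz) ih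

theorem Linked.mono {J' : Vt → Bool → Bool → Prop} (hJ : ∀ v k l, J v k l → J' v k l)
    (h : Linked M J a m b n) : Linked M J' a m b n := by
  induction h with
  | single hs => exact .single hs
  | snoc _ hz hs ih => exact ih.snoc (hJ _ _ _ hz) hs

/-- Expand every step of a walk into a walk of another graph. -/
theorem Linked.expand {N : MixedGraph Vt} {J' : Vt → Bool → Bool → Prop}
    (hJ : ∀ v k l, J v k l → J' v k l)
    (hE : ∀ s, StepIn M s → Linked N J' s.src s.hsrc s.tgt s.htgt)
    (h : Linked M J a m b n) : Linked N J' a m b n := by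
  induction h with
  | single hs => exact hE _ hs
  | snoc _ hz hs ih => exact ih.trans (hJ _ _ _ hz) (hE _ hs)

/-- A walk that starts with a tail is directed until it meets its first collider. -/
theorem Linked.transGen_or_collider (h : Linked M J a false b n) :
    (n = true ∧ Relation.TransGen M.dir a b) ∨
      ∃ z, Relation.ReflTransGen M.dir a z ∧ J z true true := by
  have key : ∀ {v w n}, StepIn M ⟨v, w, false, n⟩ → n = true ∧ M.dir v w := by
    rintro v w n (⟨-, h2, h⟩ | ⟨h1, -⟩ | ⟨h1, -⟩)
    · exact ⟨h2, h⟩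
    · simp at h1
    · simp at h1
  induction h with
  | single hs => exact Or.inl ⟨(key hs).1, .single (key hs).2⟩
  | @snoc z b k l n _ hz hs ih =>
    rcases ih with ⟨rfl, ih⟩ | ih
    · cases l with
      | true => exact Or.inr ⟨z, ih.to_reflTransGen, hz⟩
      | false => exact Or.inl ⟨(key hs).1, ih.tail (key hs).2⟩
    · exact Or.inr ih

theorem Linked.of_isWalk {p : List (Step Vt)} {s : Step Vt} (h : IsWalk M a (s :: p) b)
    (hc : List.IsChain (fun s t => J s.tgt s.htgt t.hsrc) (s :: p)) :
    Linked M J a s.hsrc b ((s :: p).getLast (List.cons_ne_nil s p)).htgt := by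
  induction p generalizing a s with
  | nil =>
    obtain ⟨rfl, hs, rfl⟩ := h
    exact .single hs
  | cons t p ih =>
    obtain ⟨rfl, hs, h⟩ := h
    rw [List.isChain_cons_cons] at hc
    exact (Linked.single hs).trans hc.1 (by simpa using ih h hc.2)

theorem isWalk_snoc {p : List (Step Vt)} (h : IsWalk M a p b) (hs : StepIn M ⟨b, c, m, n⟩) :
    IsWalk M a (p ++ [⟨b, c, m, n⟩]) c := by
  induction p generalizing a with
  | nil => exact ⟨h.symm, hs, rfl⟩
  | cons s p ih => exact ⟨h.1, h.2.1, ih h.2.2⟩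

theorem chain_and_interior {R : Step Vt → Step Vt → Prop} {Q : Vt → Prop} {p : List (Step Vt)}
    (hc : List.IsChain R p) (hQ : ∀ z ∈ interiorVerts p, Q z) :
    List.IsChain (fun s t => Q s.tgt ∧ R s t) p := by
  induction p with
  | nil => simp
  | cons s p ih =>
    cases p with
    | nil => simp
    | cons t p =>
      rw [List.isChain_cons_cons] at hc ⊢
      simp only [interiorVerts, List.map_cons, List.dropLast_cons_cons, List.mem_cons,
        forall_eq_or_imp] at hQ
      exact ⟨⟨hQ.1, hc.1⟩, ih hc.2 hQ.2⟩

namespace LinkedPath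

variable {p : List (Step Vt)}

theorem exists_last (h : LinkedPath M J a m p b n) :
    ∃ q s, p = q ++ [s] ∧ s.tgt = b ∧ s.htgt = n := by
  cases h with
  | single _ _ => exact ⟨[], _, rfl, rfl, rfl⟩
  | snoc _ _ _ _ => exact ⟨_, _, rfl, rfl, rfl⟩

theorem ne_nil (h : LinkedPath M J a m p b n) : p ≠ [] := by
  obtain ⟨q, s, rfl, -⟩ := h.exists_last
  simp

theorem isWalk (h : LinkedPath M J a m p b n) : IsWalk M a p b := by
  induction h with
  | single _ hs => exact ⟨rfl, hs, rfl⟩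
  | snoc _ _ hs _ ih => exact isWalk_snoc ih hs

theorem nodup (h : LinkedPath M J a m p b n) : (wverts a p).Nodup := by
  induction h with
  | single hne _ => simpa [wverts] using hne.symm
  | @snoc p z b k l n _ _ _ hb ih =>
    have : wverts a (p ++ [⟨z, b, l, n⟩]) = wverts a p ++ [b] := by simp [wverts]
    rw [this, List.nodup_append]
    refine ⟨ih, by simp, ?_⟩
    rintro x hx y hy rfl
    rw [List.mem_singleton] at hy
    exact hb (hy ▸ hx)

theorem chain (h : LinkedPath M J a m p b n) :
    List.IsChain (fun s t => J s.tgt s.htgt t.hsrc) p := by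
  induction h with
  | single _ _ => simp
  | snoc hp hz _ _ ih =>
    obtain ⟨q, s, rfl, rfl, rfl⟩ := hp.exists_last
    rw [List.isChain_append]
    refine ⟨ih, by simp, ?_⟩
    simpa using hz

theorem head?_hsrc (h : LinkedPath M J a m p b n) : ∀ s, p.head? = some s → s.hsrc = m := by
  induction h with
  | single _ _ => simp
  | snoc hp _ _ _ ih =>
    intro s hs
    rw [List.head?_append_of_ne_nil _ hp.ne_nil] at hs
    exact ih s hs

theorem getLast?_htgt (h : LinkedPath M J a m p b n) :
    ∀ s, p.getLast? = some s → s.htgt = n := by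
  obtain ⟨q, s, rfl, -, hs⟩ := h.exists_last
  simpa using hs

theorem interior (h : LinkedPath M J a m p b n) : ∀ z ∈ interiorVerts p, ∃ k l, J z k l := by
  induction h with
  | single _ _ => simp [interiorVerts]
  | snoc hp hz _ _ ih =>
    obtain ⟨q, s, rfl, rfl, rfl⟩ := hp.exists_last
    intro v hv
    simp only [interiorVerts, List.map_append, List.map_cons, List.map_nil,
      List.dropLast_concat, List.mem_append, List.mem_singleton] at hv ih
    rcases hv with hv | rfl
    · exact ih v hv
    · exact ⟨_, _, hz⟩

theorem directed (hJ : ∀ v, ¬ J v true true) (h : LinkedPath M J a false p b n) :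
    n = true ∧ ∀ s ∈ p, s.hsrc = false ∧ s.htgt = true := by
  induction h with
  | single _ hs => rcases hs with h | h | h <;> simp_all
  | @snoc p z b k l n _ hz hs _ ih =>
    obtain ⟨rfl, ih⟩ := ih
    obtain rfl : l = false := Bool.eq_false_of_not_eq_true fun hl => hJ z (hl ▸ hz)
    have hn : n = true := by rcases hs with h | h | h <;> simp_all
    subst hn
    refine ⟨rfl, fun s hs => ?_⟩
    rcases List.mem_append.1 hs with hs | hs
    · exact ih s hs
    · simp [List.mem_singleton.1 hs]

theorem truncate (h : LinkedPath M J a m p b n) (hc : c ∈ p.map Step.tgt) :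
    ∃ q k, LinkedPath M J a m q c k ∧
      ((c = b ∧ k = n) ∨ ∃ l, J c k l ∧ Linked M J c l b n) := by
  induction h with
  | @single b n hne hs =>
    simp only [List.map_cons, List.map_nil, List.mem_singleton] at hc
    subst hc
    exact ⟨_, _, .single hne hs, Or.inl ⟨rfl, rfl⟩⟩
  | @snoc p z b k l n hp hz hs hb ih =>
    rw [List.map_append, List.mem_append] at hc
    rcases hc with hc | hc
    · obtain ⟨q, k', hq, ⟨rfl, rfl⟩ | ⟨l', hJ, hl⟩⟩ := ih hc
      · exact ⟨q, k', hq, Or.inr ⟨l, hz, .single hs⟩⟩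
      · exact ⟨q, k', hq, Or.inr ⟨l', hJ, hl.snoc hz hs⟩⟩
    · simp only [List.map_cons, List.map_nil, List.mem_singleton] at hc
      subst hc
      exact ⟨_, _, .snoc hp hz hs hb, Or.inl ⟨rfl, rfl⟩⟩

end LinkedPath

/-- A walk between distinct vertices can be replaced by a path when the joint condition survives
the removal of closed subwalks; a mark at an endpoint is kept if the endpoint cannot be an
interior vertex. -/
theorem Linked.exists_linkedPath
    (hJ : ∀ v k l k' l', J v k l → Linked M J v l v k' → J v k' l' → J v k l')
    (h : Linked M J a m b n) (hab : b ≠ a) :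
    ∃ p m' n', LinkedPath M J a m' p b n' ∧ ((∀ k l, ¬ J a k l) → m' = m) ∧
      ((∀ k l, ¬ J b k l) → n' = n) := by
  suffices H : b = a ∨ ∃ p m' n', LinkedPath M J a m' p b n' ∧ ((∀ k l, ¬ J a k l) → m' = m) ∧
      ((∀ k l, ¬ J b k l) → n' = n) ∧ ∀ l, J b n l → J b n' l by
    obtain ⟨p, m', n', hp, hm, hn, -⟩ := H.resolve_left hab
    exact ⟨p, m', n', hp, hm, hn⟩
  clear hab
  induction h with
  | @single b n hs =>
    rcases eq_or_ne b a with hb | hb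
    · exact Or.inl hb
    · exact Or.inr ⟨_, m, n, .single hb hs, fun _ => rfl, fun _ => rfl, fun _ h => h⟩
  | @snoc z b k l n _ hz hs ih =>
    rcases eq_or_ne b a with hb | hb
    · exact Or.inl hb
    right
    rcases ih with rfl | ⟨p, m', k', hp, hm, -, hk⟩
    · exact ⟨_, l, n, .single hb hs, fun h => absurd hz (h _ _), fun _ => rfl, fun _ h => h⟩
    have hz' := hk _ hz
    by_cases hbp : b ∈ p.map Step.tgt
    · obtain ⟨q, k'', hq, ⟨rfl, rfl⟩ | ⟨l', hb', hl⟩⟩ := hp.truncate hbp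
      · exact ⟨q, m', _, hq, hm, fun h => absurd hz (h _ _),
          fun l' hl' => hJ _ _ _ _ _ hz' (.single hs) hl'⟩
      · exact ⟨q, m', _, hq, hm, fun h => absurd hb' (h _ _),
          fun l' hl' => hJ _ _ _ _ _ hb' (hl.snoc hz' hs) hl'⟩
    · refine ⟨_, m', n, hp.snoc hz' hs ?_, hm, fun _ => rfl, fun _ h => h⟩
      simpa [wverts, hb] using hbp

theorem latentOK_symm {L : Finset Vt} (v : Vt) (k l : Bool) (h : latentOK L v k l) :
    latentOK L v l k :=
  ⟨h.1, fun h' => h.2 h'.symm⟩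

theorem latentOK_excise {L : Finset Vt} (v : Vt) (k l k' l' : Bool) (h : latentOK L v k l)
    (hl : Linked M (latentOK L) v l v k') (h' : latentOK L v k' l') : latentOK L v k l' := by
  refine ⟨h.1, ?_⟩
  rintro ⟨rfl, rfl⟩
  have hl0 : l = false := by simpa using h.2
  have hk0 : k' = false := by simpa using h'.2
  subst hl0 hk0
  rcases hl.transGen_or_collider with ⟨h0, -⟩ | ⟨z, -, hz⟩
  · simp at h0
  · exact hz.2 ⟨rfl, rfl⟩

theorem ancOf_of_reflTransGen {C : Finset Vt} (h : Relation.ReflTransGen M.dir a b)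
    (hb : ancOf M C b) : ancOf M C a := by
  obtain ⟨c, hc, hbc⟩ := hb
  exact ⟨c, hc, h.trans hbc⟩

theorem markOK_true_true {C : Finset Vt} : markOK M C a true true ↔ ancOf M C a := by
  simp [markOK]

theorem markOK_of_not_mem {C : Finset Vt} (h : a ∉ C) (hkl : ¬ (k = true ∧ l = true)) :
    markOK M C a k l :=
  Or.inr ⟨hkl, h⟩

theorem not_mem_of_markOK {C : Finset Vt} (h : markOK M C a k l) (hkl : ¬ (k = true ∧ l = true)) :
    a ∉ C := by
  rcases h with h | h
  · exact absurd h.1 hkl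
  · exact h.2

theorem markOK_excise {C : Finset Vt} (v : Vt) (k l k' l' : Bool) (h : markOK M C v k l)
    (hl : Linked M (markOK M C) v l v k') (h' : markOK M C v k' l') : markOK M C v k l' := by
  cases k with
  | false => exact markOK_of_not_mem (not_mem_of_markOK h (by simp)) (by simp)
  | true =>
    cases l' with
    | false => exact markOK_of_not_mem (not_mem_of_markOK h' (by simp)) (by simp)
    | true =>
      cases l with
      | true => exact h
      | false =>
        rcases hl.transGen_or_collider with ⟨rfl, -⟩ | ⟨z, hz, hz'⟩
        · exact h'
        · exact markOK_true_true.2 (ancOf_of_reflTransGen hz (markOK_true_true.1 hz'))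

theorem markOK_join {C : Finset Vt} (h : markOK M C a k true) (h' : markOK M C a true l) :
    markOK M C a k l := by
  cases k with
  | false => exact markOK_of_not_mem (not_mem_of_markOK h (by simp)) (by simp)
  | true => exact h'

/-- m-connection of distinct vertices may be tested on walks instead of paths. -/
theorem mConn_iff_linked {C : Finset Vt} (hab : a ≠ b) :
    MConn M C a b ↔ ∃ m n, Linked M (markOK M C) a m b n := by
  constructor
  · rintro ⟨p, hp, -, hc⟩
    cases p with
    | nil => exact absurd hp hab
    | cons s p => exact ⟨_, _, Linked.of_isWalk hp hc⟩
  · rintro ⟨m, n, h⟩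
    obtain ⟨p, m', n', hp, -⟩ := h.exists_linkedPath markOK_excise hab.symm
    exact ⟨p, hp.isWalk, hp.nodup, hp.chain⟩

theorem DirVia.linked {L : Finset Vt} (h : DirVia M L a b) :
    Linked M (latentOK L) a false b true := by
  obtain ⟨p, hne, hp, -, hd, hL⟩ := h
  have hc : List.IsChain (fun s t : Step Vt => ¬ (s.htgt = true ∧ t.hsrc = true)) p := by
    refine List.Pairwise.isChain (List.pairwise_of_forall_mem_list fun s _ t ht => ?_)
    simp [(hd t ht).1]
  have hc := chain_and_interior hc hL
  cases p with
  | nil => exact absurd rfl hne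
  | cons s p =>
    have := Linked.of_isWalk (J := latentOK L) hp hc
    rwa [(hd s (by simp)).1, (hd _ (List.getLast_mem (List.cons_ne_nil s p))).2] at this

theorem BiVia.linked {L : Finset Vt} (h : BiVia M L a b) :
    Linked M (latentOK L) a true b true := by
  obtain ⟨p, hne, hp, -, hh, ht, hL, hc⟩ := h
  have hc := chain_and_interior hc hL
  cases p with
  | nil => exact absurd rfl hne
  | cons s p =>
    have := Linked.of_isWalk (J := latentOK L) hp hc
    rwa [hh s rfl, ht _ (List.getLast?_eq_getLast_of_ne_nil (List.cons_ne_nil s p))] at this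

theorem Linked.dirVia {L : Finset Vt} (ha : a ∉ L) (hab : a ≠ b)
    (h : Linked M (latentOK L) a false b n) : DirVia M L a b := by
  obtain ⟨p, m', n', hp, hm, -⟩ := h.exists_linkedPath latentOK_excise hab.symm
  obtain rfl := hm fun k l h => ha h.1
  refine ⟨p, hp.ne_nil, hp.isWalk, hp.nodup, (hp.directed fun v h => h.2 ⟨rfl, rfl⟩).2,
    fun z hz => ?_⟩
  obtain ⟨_, _, h⟩ := hp.interior z hz
  exact h.1

theorem Linked.biVia {L : Finset Vt} (ha : a ∉ L) (hb : b ∉ L) (hab : a ≠ b)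
    (h : Linked M (latentOK L) a true b true) : BiVia M L a b := by
  obtain ⟨p, m', n', hp, hm, hn⟩ := h.exists_linkedPath latentOK_excise hab.symm
  obtain rfl := hm fun k l h => ha h.1
  obtain rfl := hn fun k l h => hb h.1
  refine ⟨p, hp.ne_nil, hp.isWalk, hp.nodup, hp.head?_hsrc, hp.getLast?_htgt,
    fun z hz => ?_, ?_⟩
  · obtain ⟨_, _, h⟩ := hp.interior z hz
    exact h.1
  · exact List.IsChain.imp (fun s t h => h.2) hp.chain

end Walks

section Projection

variable {Vt : Type} {G : PreCADMG Vt} {L C : Finset Vt} {a v z : Vt} {k l m n : Bool}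

theorem linked_of_stepIn_project [DecidableEq Vt] (hbi : ∀ a b, G.bi a b → G.bi b a)
    (s : Step Vt) (hs : StepIn (project G L).mg s) :
    Linked G.mg (latentOK L) s.src s.hsrc s.tgt s.htgt := by
  rcases hs with ⟨h1, h2, -, -, -, h⟩ | ⟨h1, h2, -, -, -, h⟩ | ⟨h1, h2, -, -, -, h⟩
  · rw [h1, h2]
    exact h.linked
  · rw [h1, h2]
    exact h.linked.reverse hbi latentOK_symm
  · rw [h1, h2]
    exact h.linked

theorem stepIn_project_of_linked [DecidableEq Vt] (hbi : ∀ a b, G.bi a b → G.bi b a)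
    (ha : a ∈ G.V \ L) (hv : v ∈ G.V \ L) (hav : a ≠ v)
    (h : Linked G.mg (latentOK L) a m v n) : StepIn (project G L).mg ⟨a, v, m, n⟩ := by
  have ha' := (mem_sdiff.1 ha).2
  have hv' := (mem_sdiff.1 hv).2
  cases m with
  | false =>
    rcases h.transGen_or_collider with ⟨rfl, -⟩ | ⟨z, -, hz⟩
    · exact Or.inl ⟨rfl, rfl, mem_union_left _ ha, hv, hav, h.dirVia ha' hav⟩
    · exact absurd ⟨rfl, rfl⟩ hz.2
  | true =>
    cases n with
    | false =>
      exact Or.inr (Or.inl ⟨rfl, rfl, mem_union_left _ hv, ha, hav.symm,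
        (h.reverse hbi latentOK_symm).dirVia hv' hav.symm⟩)
    | true => exact Or.inr (Or.inr ⟨rfl, rfl, ha, hv, hav, h.biVia ha' hv' hav⟩)

theorem transGen_of_project [DecidableEq Vt] (h : (project G L).dir a v) :
    Relation.TransGen G.dir a v := by
  rcases h.2.2.2.linked.transGen_or_collider with ⟨-, h⟩ | ⟨z, -, hz⟩
  · exact h
  · exact absurd ⟨rfl, rfl⟩ hz.2

theorem ancOf_of_project [DecidableEq Vt] (h : ancOf (project G L).mg C z) : ancOf G.mg C z := by
  obtain ⟨c, hc, h⟩ := h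
  refine ⟨c, hc, ?_⟩
  clear hc
  induction h with
  | refl => exact .refl
  | tail _ h ih => exact ih.trans (transGen_of_project h).to_reflTransGen

/-- A closed walk without colliders in an acyclic graph has arrowheads at both ends. -/
theorem heads_of_closed (hbi : ∀ a b, G.bi a b → G.bi b a)
    (hac : ∀ v, ¬ Relation.TransGen G.dir v v) (h : Linked G.mg (latentOK L) v m v n) :
    m = true ∧ n = true := by
  have key : ∀ n, ¬ Linked G.mg (latentOK L) v false v n := by
    intro n h
    rcases h.transGen_or_collider with ⟨-, h⟩ | ⟨z, -, hz⟩
    · exact hac v h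
    · exact hz.2 ⟨rfl, rfl⟩
  constructor
  · by_contra hm
    rw [Bool.not_eq_true] at hm
    exact key n (hm ▸ h)
  · by_contra hn
    rw [Bool.not_eq_true] at hn
    exact key m (hn ▸ h.reverse hbi latentOK_symm)

theorem exists_observed_of_reflTransGen [DecidableEq Vt] (hbi : ∀ a b, G.bi a b → G.bi b a)
    (hac : ∀ v, ¬ Relation.TransGen G.dir v v) (hdir : ∀ a b, G.dir a b → b ∈ G.V)
    (hv : v ∈ G.V \ L) (h : Relation.ReflTransGen G.dir v z) :
    ∃ o ∈ G.V \ L, Relation.ReflTransGen (project G L).dir v o ∧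
      (o = z ∨ Linked G.mg (latentOK L) o false z true) := by
  have close : ∀ {o z}, o ∈ G.V \ L → z ∈ G.V \ L →
      Relation.ReflTransGen (project G L).dir v o →
      (o = z ∨ Linked G.mg (latentOK L) o false z true) →
      Relation.ReflTransGen (project G L).dir v z := by
    rintro o z ho hz hvo (rfl | h)
    · exact hvo
    · have hoz : o ≠ z := by
        rintro rfl
        simpa using heads_of_closed hbi hac h
      exact hvo.tail ⟨mem_union_left _ ho, hz, hoz, h.dirVia (mem_sdiff.1 ho).2 hoz⟩
  induction h with
  | refl => exact ⟨v, hv, .refl, Or.inl rfl⟩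
  | @tail z w hvz hzw ih =>
    have hs : StepIn G.mg ⟨z, w, false, true⟩ := Or.inl ⟨rfl, rfl, hzw⟩
    obtain ⟨o, ho, hvo, hoz⟩ := ih
    by_cases hz : z ∈ L
    · refine ⟨o, ho, hvo, Or.inr ?_⟩
      rcases hoz with rfl | hoz
      · exact .single hs
      · exact hoz.snoc ⟨hz, by simp⟩ hs
    · have hzV : z ∈ G.V \ L := by
        refine mem_sdiff.2 ⟨?_, hz⟩
        cases hvz with
        | refl => exact (mem_sdiff.1 hv).1
        | tail _ h => exact hdir _ _ h
      exact ⟨z, hzV, close ho hzV hvo hoz, Or.inr (.single hs)⟩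

theorem ancOf_project_iff [DecidableEq Vt] (hbi : ∀ a b, G.bi a b → G.bi b a)
    (hac : ∀ v, ¬ Relation.TransGen G.dir v v) (hdir : ∀ a b, G.dir a b → b ∈ G.V)
    (hC : C ⊆ G.V \ L) (hv : v ∈ G.V \ L) :
    ancOf (project G L).mg C v ↔ ancOf G.mg C v := by
  refine ⟨ancOf_of_project, ?_⟩
  rintro ⟨c, hc, h⟩
  obtain ⟨o, ho, hvo, rfl | h⟩ := exists_observed_of_reflTransGen hbi hac hdir hv h
  · exact ⟨_, hc, hvo⟩
  · rcases eq_or_ne o c with rfl | hoc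
    · exact ⟨_, hc, hvo⟩
    · exact ⟨c, hc, hvo.tail
        ⟨mem_union_left _ ho, hC hc, hoc, h.dirVia (mem_sdiff.1 ho).2 hoc⟩⟩

/-- A latent ancestor of `C` reaches an observed ancestor of `C` along latent vertices. -/
theorem exists_observed_descendant [DecidableEq Vt] (hdir : ∀ a b, G.dir a b → b ∈ G.V)
    (hC : C ⊆ G.V \ L) (hz : z ∈ L) (h : ancOf G.mg C z) :
    ∃ o ∈ G.V \ L, ancOf G.mg C o ∧ Linked G.mg (latentOK L) z false o true := by
  obtain ⟨c, hc, h⟩ := h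
  induction h using Relation.ReflTransGen.head_induction_on with
  | refl => exact absurd hz (mem_sdiff.1 (hC hc)).2
  | @head z w hzw hwc ih =>
    have hs : StepIn G.mg ⟨z, w, false, true⟩ := Or.inl ⟨rfl, rfl, hzw⟩
    by_cases hw : w ∈ L
    · obtain ⟨o, ho, hoc, hl⟩ := ih hw
      exact ⟨o, ho, hoc, (Linked.single hs).trans ⟨hw, by simp⟩ hl⟩
    · exact ⟨w, mem_sdiff.2 ⟨hdir _ _ hzw, hw⟩, ⟨c, hc, hwc⟩, .single hs⟩

/-- `a` is `v`, or the projection has an m-connecting walk from `a` to `v` that may be continued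
from `v` with mark `k`. -/
def Reached [DecidableEq Vt] (G : PreCADMG Vt) (L C : Finset Vt) (a v : Vt) (k : Bool) : Prop :=
  v = a ∨ ∃ m n, Linked (project G L).mg (markOK (project G L).mg C) a m v n ∧
    markOK (project G L).mg C v n k

theorem Linked.extend_project [DecidableEq Vt] (hbi : ∀ a b, G.bi a b → G.bi b a)
    (ha : a ∈ G.V \ L) (hv : v ∈ G.V \ L) (hz : z ∈ G.V \ L) (hvz : v ≠ z)
    (hr : Reached G L C a v k) (hl : Linked G.mg (latentOK L) v k z n) :
    ∃ m, Linked (project G L).mg (markOK (project G L).mg C) a m z n := by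
  rcases hr with rfl | ⟨m, n', h, hk⟩
  · exact ⟨_, .single (stepIn_project_of_linked hbi ha hz hvz hl)⟩
  · exact ⟨m, h.snoc hk (stepIn_project_of_linked hbi hv hz hvz hl)⟩

theorem Reached.advance [DecidableEq Vt] (hbi : ∀ a b, G.bi a b → G.bi b a)
    (hac : ∀ v, ¬ Relation.TransGen G.dir v v)
    (ha : a ∈ G.V \ L) (hv : v ∈ G.V \ L) (hz : z ∈ G.V \ L)
    (hr : Reached G L C a v k) (hl : Linked G.mg (latentOK L) v k z n)
    (hn : markOK (project G L).mg C z n l) : Reached G L C a z l := by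
  rcases eq_or_ne v z with rfl | hvz
  · obtain ⟨rfl, rfl⟩ := heads_of_closed hbi hac hl
    rcases hr with rfl | ⟨m, n', h, hk⟩
    · exact Or.inl rfl
    · exact Or.inr ⟨m, n', h, markOK_join hk hn⟩
  · obtain ⟨m, h⟩ := Linked.extend_project hbi ha hv hz hvz hr hl
    exact Or.inr ⟨m, n, h, hn⟩

theorem exists_reached_of_linked [DecidableEq Vt] (hbi : ∀ a b, G.bi a b → G.bi b a)
    (hac : ∀ v, ¬ Relation.TransGen G.dir v v) (hdir : ∀ a b, G.dir a b → a ∈ G.V ∧ b ∈ G.V)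
    (hbiV : ∀ a b, G.bi a b → a ∈ G.V ∧ b ∈ G.V) (hC : C ⊆ G.V \ L) (ha : a ∈ G.V \ L)
    (h : Linked G.mg (markOK G.mg C) a m z n) :
    ∃ v ∈ G.V \ L, ∃ k, Reached G L C a v k ∧ Linked G.mg (latentOK L) v k z n := by
  have hdir' : ∀ a b, G.dir a b → b ∈ G.V := fun a b h => (hdir a b h).2
  induction h with
  | single hs => exact ⟨a, ha, _, Or.inl rfl, .single hs⟩
  | @snoc z w k l n _ hz hs ih =>
    obtain ⟨v, hv, i, hr, hl⟩ := ih
    by_cases hzL : z ∈ L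
    · by_cases hkl : k = true ∧ l = true
      · obtain ⟨rfl, rfl⟩ := hkl
        obtain ⟨o, ho, hoC, hzo⟩ :=
          exists_observed_descendant hdir' hC hzL (markOK_true_true.1 hz)
        refine ⟨o, ho, true, hr.advance hbi hac ha hv ho
          (hl.trans ⟨hzL, by simp⟩ hzo) (markOK_true_true.2 ?_),
          (hzo.reverse hbi latentOK_symm).snoc ⟨hzL, by simp⟩ hs⟩
        exact (ancOf_project_iff hbi hac hdir' hC ho).2 hoC
      · exact ⟨v, hv, i, hr, hl.snoc ⟨hzL, hkl⟩ hs⟩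
    · have hzV : z ∈ G.V \ L := by
        refine mem_sdiff.2 ⟨?_, hzL⟩
        rcases hs with ⟨-, -, h⟩ | ⟨-, -, h⟩ | ⟨-, -, h⟩
        · exact (hdir _ _ h).1
        · exact (hdir _ _ h).2
        · exact (hbiV _ _ h).1
      refine ⟨z, hzV, l, hr.advance hbi hac ha hv hzV hl ?_, .single hs⟩
      exact hz.imp_left (And.imp_right (ancOf_project_iff hbi hac hdir' hC hzV).2)

/-- m-connection of distinct observed vertices is preserved by latent projection. -/
theorem mConn_project_iff [DecidableEq Vt] (hbi : ∀ a b, G.bi a b → G.bi b a)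
    (hac : ∀ v, ¬ Relation.TransGen G.dir v v) (hdir : ∀ a b, G.dir a b → a ∈ G.V ∧ b ∈ G.V)
    (hbiV : ∀ a b, G.bi a b → a ∈ G.V ∧ b ∈ G.V) (hC : C ⊆ G.V \ L) {b : Vt}
    (ha : a ∈ G.V \ L) (hb : b ∈ G.V \ L) (hab : a ≠ b) :
    MConn G.mg C a b ↔ MConn (project G L).mg C a b := by
  rw [mConn_iff_linked hab, mConn_iff_linked hab]
  constructor
  · rintro ⟨m, n, h⟩
    obtain ⟨v, hv, k, hr, hl⟩ := exists_reached_of_linked hbi hac hdir hbiV hC ha h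
    rcases eq_or_ne v b with rfl | hvb
    · obtain ⟨m, n, h, -⟩ := hr.resolve_left hab.symm
      exact ⟨m, n, h⟩
    · obtain ⟨m, h⟩ := Linked.extend_project hbi ha hv hb hvb hr hl
      exact ⟨m, n, h⟩
  · rintro ⟨m, n, h⟩
    refine ⟨m, n, h.expand (fun v k l h => h.imp_left (And.imp_right ancOf_of_project))
      fun s hs => (linked_of_stepIn_project hbi s hs).mono fun v k l h =>
        markOK_of_not_mem (fun hv => (mem_sdiff.1 (hC hv)).2 h.1) h.2⟩

end Projection

end Nested

open Nested in
/-- Let `𝒢` be a DAG with vertex set `O ∪̇ L`.  For disjoint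
subsets `A, B, C ⊆ O` (`C` possibly empty), `A` is d-separated from `B`
given `C` in `𝒢` iff `A` is m-separated from `B` given `C` in the latent
projection `𝒢(O)`. -/
theorem dsep_iff_msep_in_latent_projection
    {Vt : Type} [Fintype Vt] [DecidableEq Vt]
    (G : PreCADMG Vt) (O L : Finset Vt)
    (hWF : G.WF) (hW : G.W = ∅) (hDAG : ∀ a b, ¬ G.bi a b)
    (hV : G.V = O ∪ L) (hOL : Disjoint O L)
    (A B C : Finset Vt) (hA : A ⊆ O) (hB : B ⊆ O) (hC : C ⊆ O)
    (hAB : Disjoint A B) (hAC : Disjoint A C) (hBC : Disjoint B C) :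
    MSep G.mg A B C ↔ MSep (project G L).mg A B C := by
  have hV' : G.V \ L = O := by
    rw [hV, union_sdiff_right, sdiff_eq_self_of_disjoint hOL]
  obtain ⟨-, hbi, hdir, hbiV, hac⟩ := hWF
  have hdir' : ∀ a b, G.dir a b → a ∈ G.V ∧ b ∈ G.V := fun a b h =>
    ⟨by simpa [hW] using (hdir a b h).1, (hdir a b h).2⟩
  refine forall₄_congr fun a ha b hb => not_congr ?_
  exact mConn_project_iff hbi hac hdir' hbiV (hV' ▸ hC) (hV' ▸ hA ha) (hV' ▸ hB hb)
    (disjoint_left.1 hAB ha <| · ▸ hb)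
end

section
/- Kernel conditional independence satisfies the semi-graphoid axioms: for any kernel q_V(x_V | x_W) and pairwise disjoint sets A, B, C, D ⊆ V ∪ W, (symmetry) X_A ⫫ X_B | X_C [q_V] if and only if X_B ⫫ X_A | X_C [q_V]; and (chain rule) X_A ⫫ X_B | X_{C∪D} [q_V] together with X_A ⫫ X_D | X_C [q_V] hold if and only if X_A ⫫ X_{B∪D} | X_C [q_V]. -/
open scoped Classical
open Finset

namespace Nested

section KernelSemigraphoid

variable {Vt : Type} [DecidableEq Vt]
variable {𝔛 : Vt → Type} [∀ v, Fintype (𝔛 v)]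

theorem sumOver_union {R S : Finset Vt} (h : Disjoint R S) (f : (∀ v, 𝔛 v) → ℝ)
    (x : ∀ v, 𝔛 v) : sumOver (R ∪ S) f x = sumOver R (sumOver S f) x := by
  unfold sumOver
  rw [← Fintype.sum_prod_type']
  symm
  refine Fintype.sum_equiv (Equiv.piFinsetUnion 𝔛 h) _ _ ?_
  rintro ⟨y, z⟩
  congr 1
  funext v
  by_cases hR : v ∈ R
  · have hS : v ∉ S := Finset.disjoint_left.mp h hR
    have hU : v ∈ R ∪ S := Finset.mem_union_left _ hR
    simp only [hR, hS, hU, dif_pos, dif_neg, not_false_eq_true]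
    exact (Equiv.piFinsetUnion_left 𝔛 h hR hU).symm
  · by_cases hS : v ∈ S
    · have hU : v ∈ R ∪ S := Finset.mem_union_right _ hS
      simp only [hS, hU, dif_pos]
      exact (Equiv.piFinsetUnion_right 𝔛 h hS hU).symm
    · simp [hR, hS]

theorem sumOver_congr_off {S : Finset Vt} (f : (∀ v, 𝔛 v) → ℝ) {x y : ∀ v, 𝔛 v}
    (h : ∀ v, v ∉ S → x v = y v) : sumOver S f x = sumOver S f y := by
  unfold sumOver
  refine Finset.sum_congr rfl fun z _ => congrArg f (funext fun v => ?_)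
  split_ifs with hv
  · rfl
  · exact h v hv

theorem sumOver_nonneg {S : Finset Vt} {f : (∀ v, 𝔛 v) → ℝ} (hf : ∀ x, 0 ≤ f x)
    (x : ∀ v, 𝔛 v) : 0 ≤ sumOver S f x :=
  Finset.sum_nonneg fun _ _ => hf _

theorem le_sumOver {S : Finset Vt} {f : (∀ v, 𝔛 v) → ℝ} (hf : ∀ x, 0 ≤ f x)
    (x : ∀ v, 𝔛 v) : f x ≤ sumOver S f x := by
  have h := Finset.single_le_sum
    (f := fun y : ((v : {v : Vt // v ∈ S}) → 𝔛 v.1) =>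
      f (fun v => if h : v ∈ S then y ⟨v, h⟩ else x v))
    (fun _ _ => hf _) (Finset.mem_univ fun v : {v : Vt // v ∈ S} => x v.1)
  simpa [sumOver] using h

/-- Cross-multiplied identities may be summed over the coordinates in `R` of each state
independently. -/
theorem sumOver_mul_sumOver_comm {R : Finset Vt} {f g : (∀ v, 𝔛 v) → ℝ} {x y : ∀ v, 𝔛 v}
    (h : ∀ x' y' : ∀ v, 𝔛 v, (∀ v, v ∉ R → x' v = x v) → (∀ v, v ∉ R → y' v = y v) →
      f x' * g y' = f y' * g x') :
    sumOver R f x * sumOver R g y = sumOver R f y * sumOver R g x := by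
  unfold sumOver
  rw [Finset.sum_mul_sum, Finset.sum_mul_sum, Finset.sum_comm]
  refine Finset.sum_congr rfl fun _ _ => Finset.sum_congr rfl fun _ _ => h _ _ ?_ ?_ <;>
  · intro v hv
    simp [hv]

/-- Proportionality on the fibre over one state is preserved by summing over `R`. -/
theorem mul_sumOver_eq {R : Finset Vt} {f g : (∀ v, 𝔛 v) → ℝ} {x : ∀ v, 𝔛 v} {a b : ℝ}
    (h : ∀ y : ∀ v, 𝔛 v, (∀ v, v ∉ R → y v = x v) → a * f y = b * g y) :
    a * sumOver R f x = b * sumOver R g x := by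
  unfold sumOver
  rw [Finset.mul_sum, Finset.mul_sum]
  refine Finset.sum_congr rfl fun _ _ => h _ ?_
  intro v hv
  simp [hv]

/-- Proportionality between two states with common `R`-coordinates is preserved by summing
over `R`. -/
theorem sumOver_mul_eq {R : Finset Vt} {f : (∀ v, 𝔛 v) → ℝ} {x y : ∀ v, 𝔛 v} {a b : ℝ}
    (h : ∀ x' y' : ∀ v, 𝔛 v, (∀ v, v ∉ R → x' v = x v) → (∀ v, v ∉ R → y' v = y v) →
      (∀ v ∈ R, x' v = y' v) → f x' * a = f y' * b) :
    sumOver R f x * a = sumOver R f y * b := by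
  unfold sumOver
  rw [Finset.sum_mul, Finset.sum_mul]
  refine Finset.sum_congr rfl fun _ _ => h _ _ ?_ ?_ ?_ <;>
  · intro v hv
    simp [hv]

/-- The marginal kernel `q_V(x_S | x_W)`. -/
noncomputable def marg (V : Finset Vt) (q : (∀ v, 𝔛 v) → ℝ) (S : Finset Vt) :
    (∀ v, 𝔛 v) → ℝ :=
  sumOver (V \ S) q

theorem marg_eq_sumOver (V : Finset Vt) (q : (∀ v, 𝔛 v) → ℝ) {S T : Finset Vt} (h : S ⊆ T) :
    marg V q S = sumOver (V ∩ (T \ S)) (marg V q T) := by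
  funext x
  unfold marg
  rw [← sumOver_union]
  · congr 1
    grind
  · rw [Finset.disjoint_left]
    grind

theorem marg_congr {V : Finset Vt} (q : (∀ v, 𝔛 v) → ℝ) {S : Finset Vt} {x y : ∀ v, 𝔛 v}
    (h : ∀ v, v ∉ V \ S → x v = y v) : marg V q S x = marg V q S y :=
  sumOver_congr_off q h

theorem marg_nonneg {V : Finset Vt} {q : (∀ v, 𝔛 v) → ℝ} (hq : ∀ x, 0 ≤ q x)
    (S : Finset Vt) (x : ∀ v, 𝔛 v) : 0 ≤ marg V q S x :=
  sumOver_nonneg hq x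

theorem marg_eq_zero_of_subset {V : Finset Vt} {q : (∀ v, 𝔛 v) → ℝ} (hq : ∀ x, 0 ≤ q x)
    {S T : Finset Vt} (h : S ⊆ T) {x : ∀ v, 𝔛 v} (hx : marg V q S x = 0) :
    marg V q T x = 0 := by
  refine le_antisymm ?_ (marg_nonneg hq T x)
  rw [marg_eq_sumOver V q h] at hx
  exact hx ▸ le_sumOver (marg_nonneg hq T) x

/-- The function part of `KIndepA` in cross-multiplied form: the conditional kernel of `A` given
`B ∪ C` and the fixed coordinates is a function of `x_A, x_C` only. -/
def CrossIndep (V : Finset Vt) (q : (∀ v, 𝔛 v) → ℝ) (A B C : Finset Vt) : Prop :=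
  ∀ x y : ∀ v, 𝔛 v, (∀ v ∈ A ∪ C, x v = y v) →
    marg V q (A ∪ B ∪ C) x * marg V q (B ∪ C) y = marg V q (A ∪ B ∪ C) y * marg V q (B ∪ C) x

theorem kIndepA_iff {V W : Finset Vt} {q : (∀ v, 𝔛 v) → ℝ} (hq : ∀ x, 0 ≤ q x)
    (A B C : Finset Vt) :
    KIndepA V W q A B C ↔ A ∩ W = ∅ ∧ CrossIndep V q A B C := by
  have hsub : B ∪ C ⊆ A ∪ B ∪ C := by grind
  refine and_congr_right fun _ => ⟨fun h x y hxy => ?_, fun h x y hxy hx hy => ?_⟩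
  · rcases (marg_nonneg hq (B ∪ C) x).eq_or_lt with hx | hx
    · rw [← hx, marg_eq_zero_of_subset hq hsub hx.symm, zero_mul, mul_zero]
    rcases (marg_nonneg hq (B ∪ C) y).eq_or_lt with hy | hy
    · rw [← hy, marg_eq_zero_of_subset hq hsub hy.symm, zero_mul, mul_zero]
    exact (div_eq_div_iff hx.ne' hy.ne').mp (h x y hxy hx hy)
  · exact (div_eq_div_iff hx.ne' hy.ne').mpr (h x y hxy)

namespace CrossIndep

variable {V : Finset Vt} {q : (∀ v, 𝔛 v) → ℝ} {A B C D : Finset Vt}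

theorem marg_mul_marg (h : CrossIndep V q A B C) (hAB : Disjoint A B)
    (x : ∀ v, 𝔛 v) :
    marg V q (A ∪ B ∪ C) x * marg V q C x = marg V q (A ∪ C) x * marg V q (B ∪ C) x := by
  rw [Finset.disjoint_left] at hAB
  rw [marg_eq_sumOver V q (show C ⊆ B ∪ C by grind),
    marg_eq_sumOver V q (show A ∪ C ⊆ A ∪ B ∪ C by grind),
    show (A ∪ B ∪ C) \ (A ∪ C) = (B ∪ C) \ C by grind, mul_comm (sumOver _ _ _)]
  refine mul_sumOver_eq fun y hy => ?_
  rw [h x y fun v hv => (hy v (by grind)).symm, mul_comm]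

theorem decomposition (h : CrossIndep V q A (B ∪ D) C) (hAB : Disjoint A B) :
    CrossIndep V q A D C := by
  intro x y hxy
  rw [Finset.disjoint_left] at hAB
  rw [marg_eq_sumOver V q (show D ∪ C ⊆ B ∪ D ∪ C by grind),
    marg_eq_sumOver V q (show A ∪ D ∪ C ⊆ A ∪ (B ∪ D) ∪ C by grind),
    show (A ∪ (B ∪ D) ∪ C) \ (A ∪ D ∪ C) = (B ∪ D ∪ C) \ (D ∪ C) by grind]
  refine sumOver_mul_sumOver_comm fun x' y' hx hy => h x' y' fun v hv => ?_
  rw [hx v (by grind), hy v (by grind), hxy v hv]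

theorem weak_union (h : CrossIndep V q A (B ∪ D) C) : CrossIndep V q A B (C ∪ D) := by
  intro x y hxy
  have := h x y fun v hv => hxy v (by grind)
  rwa [show A ∪ (B ∪ D) ∪ C = A ∪ B ∪ (C ∪ D) by grind,
    show B ∪ D ∪ C = B ∪ (C ∪ D) by grind] at this

theorem decomposition_left (h : CrossIndep V q (B ∪ D) A C) (hBV : B ⊆ V)
    (hAB : Disjoint A B) (hBC : Disjoint B C) (hBD : Disjoint B D) :
    CrossIndep V q D A C := by
  intro x y hxy
  rw [Finset.disjoint_left] at hAB hBC hBD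
  rw [marg_eq_sumOver V q (show D ∪ A ∪ C ⊆ B ∪ D ∪ A ∪ C by grind)]
  refine sumOver_mul_eq fun x' y' hx hy hR => ?_
  rw [marg_congr q (S := A ∪ C) (x := x) (y := x') fun v hv => (hx v (by grind)).symm,
    marg_congr q (S := A ∪ C) (x := y) (y := y') fun v hv => (hy v (by grind)).symm]
  refine h x' y' fun v hv => ?_
  by_cases hvB : v ∈ B
  · exact hR v (by grind)
  · rw [hx v (by grind), hy v (by grind), hxy v (by grind)]

theorem weak_union_left (hq : ∀ x, 0 ≤ q x) (h : CrossIndep V q (B ∪ D) A C) (hBV : B ⊆ V)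
    (hAB : Disjoint A B) (hBC : Disjoint B C) (hBD : Disjoint B D) :
    CrossIndep V q B A (C ∪ D) := by
  intro x y hxy
  have h₁ := h x y fun v hv => hxy v (by grind)
  have h₂ := h.decomposition_left hBV hAB hBC hBD x y fun v hv => hxy v (by grind)
  have hz := fun z => marg_eq_zero_of_subset hq (V := V) (x := z)
    (show A ∪ C ⊆ D ∪ A ∪ C by grind)
  have hz' := fun z => marg_eq_zero_of_subset hq (V := V) (x := z)
    (show A ∪ C ⊆ B ∪ D ∪ A ∪ C by grind)
  rw [show B ∪ A ∪ (C ∪ D) = B ∪ D ∪ A ∪ C by grind, show A ∪ (C ∪ D) = D ∪ A ∪ C by grind]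
  by_cases hx : marg V q (A ∪ C) x = 0
  · rw [hz x hx, hz' x hx, zero_mul, mul_zero]
  by_cases hy : marg V q (A ∪ C) y = 0
  · rw [hz y hy, hz' y hy, zero_mul, mul_zero]
  apply mul_right_cancel₀ hx
  apply mul_right_cancel₀ hy
  grind

theorem contraction_left (hq : ∀ x, 0 ≤ q x) (h₁ : CrossIndep V q B A (C ∪ D))
    (h₂ : CrossIndep V q D A C) : CrossIndep V q (B ∪ D) A C := by
  intro x y hxy
  have e₁ := h₁ x y fun v hv => hxy v (by grind)
  have e₂ := h₂ x y fun v hv => hxy v (by grind)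
  have hz := fun z => marg_eq_zero_of_subset hq (V := V) (x := z)
    (show D ∪ A ∪ C ⊆ B ∪ D ∪ A ∪ C by grind)
  rw [show B ∪ A ∪ (C ∪ D) = B ∪ D ∪ A ∪ C by grind,
    show A ∪ (C ∪ D) = D ∪ A ∪ C by grind] at e₁
  by_cases hx : marg V q (D ∪ A ∪ C) x = 0
  · rw [hx, zero_mul] at e₂
    rcases mul_eq_zero.mp e₂.symm with hy | hx'
    · rw [hz x hx, hz y hy, zero_mul, zero_mul]
    · rw [hz x hx, hx', zero_mul, mul_zero]
  by_cases hy : marg V q (D ∪ A ∪ C) y = 0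
  · rw [hy, zero_mul] at e₂
    rcases mul_eq_zero.mp e₂ with hx' | hy'
    · exact absurd hx' hx
    · rw [hz y hy, hy', zero_mul, mul_zero]
  apply mul_right_cancel₀ hx
  apply mul_right_cancel₀ hy
  grind

/-- Contraction, where the first independence enters only through its symmetric pointwise
consequence `marg_mul_marg`. -/
theorem contraction (hq : ∀ x, 0 ≤ q x)
    (h₁ : ∀ x, marg V q (A ∪ B ∪ (C ∪ D)) x * marg V q (C ∪ D) x =
      marg V q (A ∪ (C ∪ D)) x * marg V q (B ∪ (C ∪ D)) x)
    (h₂ : CrossIndep V q A D C) : CrossIndep V q A (B ∪ D) C := by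
  intro x y hxy
  have e₂ := h₂ x y hxy
  have hz := fun z => marg_eq_zero_of_subset hq (V := V) (x := z)
    (show C ∪ D ⊆ B ∪ (C ∪ D) by grind)
  have hz' := fun z => marg_eq_zero_of_subset hq (V := V) (x := z)
    (show C ∪ D ⊆ A ∪ B ∪ (C ∪ D) by grind)
  have e := h₁ x
  have e' := h₁ y
  rw [show A ∪ D ∪ C = A ∪ (C ∪ D) by grind, show D ∪ C = C ∪ D by grind] at e₂
  rw [show A ∪ (B ∪ D) ∪ C = A ∪ B ∪ (C ∪ D) by grind,
    show B ∪ D ∪ C = B ∪ (C ∪ D) by grind]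
  by_cases hx : marg V q (C ∪ D) x = 0
  · rw [hz x hx, hz' x hx, zero_mul, mul_zero]
  by_cases hy : marg V q (C ∪ D) y = 0
  · rw [hz y hy, hz' y hy, zero_mul, mul_zero]
  apply mul_right_cancel₀ hx
  apply mul_right_cancel₀ hy
  grind

theorem of_mixed (hq : ∀ x, 0 ≤ q x) (h₁ : CrossIndep V q A B (C ∪ D))
    (h₂ : CrossIndep V q D A C) (hDV : D ⊆ V)
    (hAB : Disjoint A B) (hAD : Disjoint A D) (hCD : Disjoint C D) :
    CrossIndep V q A D C := by
  have h₃ : CrossIndep V q A ∅ (C ∪ D) := by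
    refine decomposition (B := B) ?_ hAB
    rwa [Finset.union_empty]
  have h₄ : CrossIndep V q D ∅ C := by
    refine decomposition (B := A) ?_ hAD.symm
    rwa [Finset.union_empty]
  have hloc := h₂.marg_mul_marg hAD.symm
  intro x y hxy
  rw [Finset.disjoint_left] at hAD hCD
  let y' : ∀ v, 𝔛 v := fun v => if v ∈ D then x v else y v
  have hyC : marg V q C y' = marg V q C y := marg_congr q fun v hv => if_neg (by grind)
  have hyAC : marg V q (A ∪ C) y' = marg V q (A ∪ C) y :=
    marg_congr q fun v hv => if_neg (by grind)
  have hxy' : ∀ v ∈ A ∪ C ∪ D, x v = y' v := by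
    intro v hv
    by_cases hvD : v ∈ D
    · exact (if_pos hvD).symm
    · exact (hxy v (by grind)).trans (if_neg hvD).symm
  have e₃ := h₃ x y' fun v hv => hxy' v (by grind)
  have e₄ := h₄ x y' fun v hv => hxy' v (by grind)
  have l := hloc y
  have l' := hloc y'
  simp only [Finset.union_empty, Finset.empty_union] at e₃ e₄
  rw [show A ∪ (C ∪ D) = A ∪ D ∪ C by grind, show C ∪ D = D ∪ C by grind] at e₃
  rw [show D ∪ A ∪ C = A ∪ D ∪ C by grind] at l l'
  rw [hyC] at e₄ l'
  rw [hyAC] at l'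
  have hz := fun z => marg_eq_zero_of_subset hq (V := V) (x := z)
    (show C ⊆ D ∪ C by grind)
  have hz' := fun z => marg_eq_zero_of_subset hq (V := V) (x := z)
    (show D ∪ C ⊆ A ∪ D ∪ C by grind)
  by_cases hx : marg V q (D ∪ C) x = 0
  · rw [hx, hz' x hx, zero_mul, mul_zero]
  by_cases hy : marg V q (D ∪ C) y = 0
  · rw [hy, hz' y hy, zero_mul, mul_zero]
  have hCy : marg V q C y ≠ 0 := fun h => hy (hz y h)
  have hy' : marg V q (D ∪ C) y' ≠ 0 := by
    intro h
    rw [h, zero_mul] at e₄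
    exact (mul_ne_zero hx hCy) e₄
  apply mul_right_cancel₀ hy'
  apply mul_right_cancel₀ hCy
  grind

end CrossIndep

end KernelSemigraphoid

end Nested

open Nested in
/-- Kernel conditional independence satisfies the semi-graphoid
axioms: symmetry and the chain rule. -/
theorem kernel_semigraphoid
    {Vt : Type} [Fintype Vt] [DecidableEq Vt]
    {𝔛 : Vt → Type} [∀ v, Fintype (𝔛 v)]
    (V W : Finset Vt) (hVW : Disjoint V W)
    (q : (∀ v, 𝔛 v) → ℝ) (hq : IsKernel V W q)
    (A B C D : Finset Vt)
    (hA : A ⊆ V ∪ W) (hB : B ⊆ V ∪ W) (hC : C ⊆ V ∪ W) (hD : D ⊆ V ∪ W)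
    (hAB : Disjoint A B) (hAC : Disjoint A C) (hAD : Disjoint A D)
    (hBC : Disjoint B C) (hBD : Disjoint B D) (hCD : Disjoint C D) :
    (KIndep V W q A B C ↔ KIndep V W q B A C) ∧
    ((KIndep V W q A B (C ∪ D) ∧ KIndep V W q A D C) ↔
      KIndep V W q A (B ∪ D) C) := by
  have hq0 := hq.1
  have hsub : ∀ S : Finset Vt, S ⊆ V ∪ W → S ∩ W = ∅ → S ⊆ V := by
    intro S hS hSW v hv
    have hvW : v ∉ W := fun h => Finset.notMem_empty v (hSW ▸ Finset.mem_inter.mpr ⟨hv, h⟩)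
    exact (Finset.mem_union.mp (hS hv)).resolve_right hvW
  refine ⟨or_comm, ?_⟩
  simp only [KIndep, kIndepA_iff hq0]
  constructor
  · rintro ⟨h₁ | h₁, h₂ | h₂⟩
    · exact Or.inl ⟨h₁.1, h₂.2.contraction hq0 (h₁.2.marg_mul_marg hAB)⟩
    · have h := CrossIndep.of_mixed hq0 h₁.2 h₂.2 (hsub D hD h₂.1) hAB hAD hCD
      exact Or.inl ⟨h₁.1, h.contraction hq0 (h₁.2.marg_mul_marg hAB)⟩
    · refine Or.inl ⟨h₂.1, h₂.2.contraction hq0 fun x => ?_⟩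
      rw [Finset.union_comm A B, h₁.2.marg_mul_marg hAB.symm, mul_comm]
    · refine Or.inr ⟨?_, h₁.2.contraction_left hq0 h₂.2⟩
      rw [Finset.union_inter_distrib_right, h₁.1, h₂.1, Finset.union_empty]
  · rintro (h | h)
    · exact ⟨Or.inl ⟨h.1, h.2.weak_union⟩, Or.inl ⟨h.1, h.2.decomposition hAB⟩⟩
    · obtain ⟨hBW, hDW⟩ := Finset.union_eq_empty.mp
        ((Finset.union_inter_distrib_right B D W).symm.trans h.1)
      have hBV := hsub B hB hBW
      exact ⟨Or.inr ⟨hBW, h.2.weak_union_left hq0 hBV hAB hBC hBD⟩,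
        Or.inr ⟨hDW, h.2.decomposition_left hBV hAB hBC hBD⟩⟩
end
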